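/- Let G be the wallpaper group p6m given by the presentation ⟨R, R₁, R₂ | R² = R₁² = R₂² = (R₁R₂)³ = (R₂R)² = (RR₁)⁶ = 1⟩, with generating set S the images of R, R₁, R₂ (Cayley graph the tiling 4.6.12). Then the spherical growth function satisfies δ(0) = 1, and for all n > 0: δ(n) = 12n/5 if n ≡ 0 (mod 5), δ(n) = (12n+3)/5 if n ≡ 1 (mod 5), δ(n) = (12n+1)/5 if n ≡ 2 (mod 5), δ(n) = (12n−1)/5 if n ≡ 3 (mod 5), and δ(n) = (12n−3)/5 if n ≡ 4 (mod 5). -/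

import Mathlib

/-- Word length w.r.t. `S ∪ S⁻¹`. -/
noncomputable def wordLength {G : Type*} [Group G] (S : Set G) (g : G) : ℕ :=
  sInf {n | ∃ w : List G, (∀ x ∈ w, x ∈ S ∪ S⁻¹) ∧ w.length = n ∧ w.prod = g}

/-- The spherical growth function `δ(n) = #{g : |g| = n}`. -/
noncomputable def sphericalGrowth {G : Type*} [Group G] (S : Set G) (n : ℕ) : ℕ :=
  Set.ncard {g : G | wordLength S g = n}

/-- The cumulative growth function `γ(n) = #{g : |g| ≤ n}`. -/
noncomputable def cumulativeGrowth {G : Type*} [Group G] (S : Set G) (n : ℕ) : ℕ :=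
  Set.ncard {g : G | wordLength S g ≤ n}

/-- The relators of the wallpaper group
`p6m = ⟨R,R₁,R₂ | R² = R₁² = R₂² = (R₁R₂)³ = (R₂R)² = (RR₁)⁶ = 1⟩`,
with `R, R₁, R₂` indexed by `0, 1, 2`. -/
def p6mRels : Set (FreeGroup (Fin 3)) :=
  {(FreeGroup.of 0) ^ 2, (FreeGroup.of 1) ^ 2, (FreeGroup.of 2) ^ 2,
    (FreeGroup.of 1 * FreeGroup.of 2) ^ 3, (FreeGroup.of 2 * FreeGroup.of 0) ^ 2,
    (FreeGroup.of 0 * FreeGroup.of 1) ^ 6}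

namespace P6M

/-- Normal forms `v_k * T₂^b * T₁^a * w`, recorded as `(k, a, b, w)`. -/
abbrev X := Fin 12 × ℕ × ℕ × Fin 12

/-- Left multiplication by `R` on the finite dihedral subgroup generated by `R, R₁`. -/
def m0 : Fin 12 → Fin 12 := ![1, 0, 3, 2, 5, 4, 7, 6, 9, 8, 11, 10]

/-- Left multiplication by `R₁` on the same subgroup. -/
def m1 : Fin 12 → Fin 12 := ![2, 4, 0, 6, 1, 8, 3, 10, 5, 11, 7, 9]

/-- Left multiplication by `R` on normal forms. -/
def A0 : X → X
  | (0, a, 0, w) => (0, a, 0, m0 w)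
  | (0, a, b + 1, w) => (10, a, b, w)
  | (1, a, 0, w) => (1, a, 0, m0 w)
  | (1, a, b + 1, w) => (11, a, b, w)
  | (2, a, b, w) => (3, a, b, w)
  | (3, a, b, w) => (2, a, b, w)
  | (4, a, b, w) => (5, a, b, w)
  | (5, a, b, w) => (4, a, b, w)
  | (6, a, b, w) => (7, a, b, w)
  | (7, a, b, w) => (6, a, b, w)
  | (8, a, b, w) => (9, a, b, w)
  | (9, a, b, w) => (8, a, b, w)
  | (10, a, b, w) => (0, a, b + 1, w)
  | (11, a, b, w) => (1, a, b + 1, w)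

/-- Left multiplication by `R₁` on normal forms. -/
def A1 : X → X
  | (0, 0, b, w) => (0, 0, b, m1 w)
  | (0, a + 1, b, w) => (5, a, b, w)
  | (1, a, b, w) => (2, a, b, w)
  | (2, a, b, w) => (1, a, b, w)
  | (3, a, b, w) => (4, a, b, w)
  | (4, a, b, w) => (3, a, b, w)
  | (5, a, b, w) => (0, a + 1, b, w)
  | (6, 0, b, w) => (6, 0, b, m1 w)
  | (6, a + 1, b, w) => (11, a, b, w)
  | (7, a, b, w) => (8, a, b, w)
  | (8, a, b, w) => (7, a, b, w)
  | (9, a, b, w) => (10, a, b, w)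
  | (10, a, b, w) => (9, a, b, w)
  | (11, a, b, w) => (6, a + 1, b, w)

/-- Left multiplication by `R₂` on normal forms. -/
def A2 : X → X
  | (0, a, b, w) => (1, a, b, w)
  | (1, a, b, w) => (0, a, b, w)
  | (2, 0, b, w) => (2, 0, b, m1 w)
  | (2, a + 1, b, w) => (8, a, b, w)
  | (3, 0, b, w) => (3, 0, b, m1 w)
  | (3, a + 1, b, w) => (9, a, b, w)
  | (4, a, b, w) => (6, a, b, w)
  | (5, a, b, w) => (7, a, b, w)
  | (6, a, b, w) => (4, a, b, w)
  | (7, a, b, w) => (5, a, b, w)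
  | (8, a, b, w) => (2, a + 1, b, w)
  | (9, a, b, w) => (3, a + 1, b, w)
  | (10, a, b, w) => (11, a, b, w)
  | (11, a, b, w) => (10, a, b, w)

theorem A0_A0 (x : X) : A0 (A0 x) = x := by
  obtain ⟨k, a, b, w⟩ := x
  fin_cases k <;> rcases b with _ | b <;> first | rfl | (fin_cases w <;> rfl)

theorem A1_A1 (x : X) : A1 (A1 x) = x := by
  obtain ⟨k, a, b, w⟩ := x
  fin_cases k <;> rcases a with _ | a <;> first | rfl | (fin_cases w <;> rfl)

theorem A2_A2 (x : X) : A2 (A2 x) = x := by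
  obtain ⟨k, a, b, w⟩ := x
  fin_cases k <;> rcases a with _ | a <;> first | rfl | (fin_cases w <;> rfl)

theorem A20 (x : X) : A2 (A0 (A2 (A0 x))) = x := by
  obtain ⟨k, a, b, w⟩ := x
  fin_cases k <;> rcases a with _ | a <;> rcases b with _ | b <;>
    first | rfl | (fin_cases w <;> rfl)

theorem A12 (x : X) : A1 (A2 (A1 (A2 (A1 (A2 x))))) = x := by
  obtain ⟨k, a, b, w⟩ := x
  fin_cases k <;> rcases a with _ | _ | a <;> rcases b with _ | b <;>
    first | rfl | (fin_cases w <;> rfl)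

set_option maxHeartbeats 4000000 in
theorem A01 (x : X) :
    A0 (A1 (A0 (A1 (A0 (A1 (A0 (A1 (A0 (A1 (A0 (A1 x))))))))))) = x := by
  obtain ⟨k, a, b, w⟩ := x
  fin_cases k <;> rcases a with _ | a <;> rcases b with _ | b <;>
    first | rfl | (fin_cases w <;> rfl)

/-- The generators as permutations of the normal forms. -/
def gen : Fin 3 → Equiv.Perm X :=
  ![Function.Involutive.toPerm A0 A0_A0, Function.Involutive.toPerm A1 A1_A1,
    Function.Involutive.toPerm A2 A2_A2]

@[simp] theorem gen0 (x : X) : gen 0 x = A0 x := rfl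
@[simp] theorem gen1 (x : X) : gen 1 x = A1 x := rfl
@[simp] theorem gen2 (x : X) : gen 2 x = A2 x := rfl

abbrev G := PresentedGroup p6mRels

theorem gen_rels : ∀ r ∈ p6mRels, FreeGroup.lift gen r = 1 := by
  intro r hr
  simp only [p6mRels, Set.mem_insert_iff, Set.mem_singleton_iff] at hr
  rcases hr with rfl | rfl | rfl | rfl | rfl | rfl <;> ext1 x <;>
    simp only [map_pow, map_mul, FreeGroup.lift_apply_of, pow_succ, pow_zero, one_mul,
      Equiv.Perm.mul_apply, gen0, gen1, gen2, Equiv.Perm.one_apply,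
      A0_A0, A1_A1, A2_A2, A20, A12, A01]

/-- The action of the group on normal forms. -/
def act : G →* Equiv.Perm X := PresentedGroup.toGroup gen_rels

theorem act_of (i : Fin 3) (x : X) : act (PresentedGroup.of i) x = gen i x := by
  simp [act]

def r0 : G := PresentedGroup.of 0
def r1 : G := PresentedGroup.of 1
def r2 : G := PresentedGroup.of 2

theorem rel_one {r : FreeGroup (Fin 3)} (h : r ∈ p6mRels) : PresentedGroup.mk p6mRels r = 1 :=
  PresentedGroup.one_of_mem h

theorem h00 : r0 * r0 = 1 := by
  have := rel_one (r := (FreeGroup.of 0) ^ 2) (by simp [p6mRels])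
  rw [map_pow, pow_two] at this
  exact this

theorem h11 : r1 * r1 = 1 := by
  have := rel_one (r := (FreeGroup.of 1) ^ 2) (by simp [p6mRels])
  rw [map_pow, pow_two] at this
  exact this

theorem h22 : r2 * r2 = 1 := by
  have := rel_one (r := (FreeGroup.of 2) ^ 2) (by simp [p6mRels])
  rw [map_pow, pow_two] at this
  exact this

theorem h12' : (r1 * r2) ^ 3 = 1 := by
  have := rel_one (r := (FreeGroup.of 1 * FreeGroup.of 2) ^ 3) (by simp [p6mRels])
  rw [map_pow, map_mul] at this
  exact this

theorem h20' : (r2 * r0) ^ 2 = 1 := by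
  have := rel_one (r := (FreeGroup.of 2 * FreeGroup.of 0) ^ 2) (by simp [p6mRels])
  rw [map_pow, map_mul] at this
  exact this

theorem h01' : (r0 * r1) ^ 6 = 1 := by
  have := rel_one (r := (FreeGroup.of 0 * FreeGroup.of 1) ^ 6) (by simp [p6mRels])
  rw [map_pow, map_mul] at this
  exact this

theorem i0 : r0⁻¹ = r0 := inv_eq_of_mul_eq_one_left h00
theorem i1 : r1⁻¹ = r1 := inv_eq_of_mul_eq_one_left h11
theorem i2 : r2⁻¹ = r2 := inv_eq_of_mul_eq_one_left h22

theorem c00 (x : G) : r0 * (r0 * x) = x := by rw [← mul_assoc, h00, one_mul]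
theorem c11 (x : G) : r1 * (r1 * x) = x := by rw [← mul_assoc, h11, one_mul]
theorem c22 (x : G) : r2 * (r2 * x) = x := by rw [← mul_assoc, h22, one_mul]

theorem b20 : r2 * r0 = r0 * r2 := by
  have h := h20'
  rw [pow_two] at h
  have := eq_inv_of_mul_eq_one_left h
  rwa [mul_inv_rev, i0, i2] at this

theorem b12 : r1 * (r2 * r1) = r2 * (r1 * r2) := by
  have h : (r1 * (r2 * r1)) * (r2 * (r1 * r2)) = 1 := by
    rw [← h12']; simp only [pow_succ, pow_zero, one_mul, mul_assoc]
  have := eq_inv_of_mul_eq_one_left h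
  rwa [mul_inv_rev, mul_inv_rev, i1, i2, mul_assoc] at this

theorem b01 : r1 * (r0 * (r1 * (r0 * (r1 * r0)))) = r0 * (r1 * (r0 * (r1 * (r0 * r1)))) := by
  have h : (r0 * (r1 * (r0 * (r1 * (r0 * r1))))) * (r0 * (r1 * (r0 * (r1 * (r0 * r1))))) = 1 := by
    rw [← h01']; simp only [pow_succ, pow_zero, one_mul, mul_assoc]
  have := eq_inv_of_mul_eq_one_left h
  simp only [mul_inv_rev, i0, i1, mul_assoc] at this
  exact this.symm

theorem d20 (x : G) : r2 * (r0 * x) = r0 * (r2 * x) := by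
  simp only [← mul_assoc, b20]

theorem d12 (x : G) : r1 * (r2 * (r1 * x)) = r2 * (r1 * (r2 * x)) := by
  have := congrArg (· * x) b12
  simpa only [mul_assoc] using this

theorem d01 (x : G) : r1 * (r0 * (r1 * (r0 * (r1 * (r0 * x))))) =
    r0 * (r1 * (r0 * (r1 * (r0 * (r1 * x))))) := by
  have := congrArg (· * x) b01
  simpa only [mul_assoc] using this

/-- The two dominant translations. -/
def T1 : G := r1 * (r0 * (r1 * (r0 * (r1 * r2))))
def T2 : G := r0 * (r1 * (r0 * (r1 * (r2 * (r0 * (r1 * (r0 * (r1 * r2))))))))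

def v : Fin 12 → G :=
  ![1, r2, r1 * r2, r0 * (r1 * r2), r1 * (r0 * (r1 * r2)), r0 * (r1 * (r0 * (r1 * r2))),
    r2 * (r1 * (r0 * (r1 * r2))), r2 * (r0 * (r1 * (r0 * (r1 * r2)))),
    r1 * (r2 * (r0 * (r1 * (r0 * (r1 * r2))))),
    r0 * (r1 * (r2 * (r0 * (r1 * (r0 * (r1 * r2)))))),
    r1 * (r0 * (r1 * (r2 * (r0 * (r1 * (r0 * (r1 * r2))))))),
    r2 * (r1 * (r0 * (r1 * (r2 * (r0 * (r1 * (r0 * (r1 * r2))))))))]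

def u : Fin 12 → G :=
  ![1, r0, r1, r0 * r1, r1 * r0, r0 * (r1 * r0), r1 * (r0 * r1), r0 * (r1 * (r0 * r1)),
    r1 * (r0 * (r1 * r0)), r0 * (r1 * (r0 * (r1 * r0))), r1 * (r0 * (r1 * (r0 * r1))),
    r0 * (r1 * (r0 * (r1 * (r0 * r1))))]

theorem u0 (w : Fin 12) : u (m0 w) = r0 * u w := by
  fin_cases w <;> simp [u, m0, h00, c00]

theorem u1 (w : Fin 12) : u (m1 w) = r1 * u w := by
  fin_cases w <;> simp [u, m1, h11, c11]
  · rw [b01]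
  · rw [← b01, c11]

theorem T1_r0 : r0 * T1 = T1 * r0 := by
  simp only [T1, mul_assoc, b20]
  rw [d01]

theorem T2_r1 : r1 * T2 = T2 * r1 := by
  simp only [T2, mul_assoc]
  simp only [d20]
  rw [d01, b12, d12]
  simp only [d20]

theorem T1_T2 : T1 * T2 = T2 * T1 := by
  simp only [T1, T2, mul_assoc, d20]
  rw [d01]
  simp only [d12, d20]

theorem T1_r0_pow (a : ℕ) : r0 * T1 ^ a = T1 ^ a * r0 :=
  (Commute.pow_right (show Commute r0 T1 from T1_r0) a)

theorem T2_r1_pow (a : ℕ) : r1 * T2 ^ a = T2 ^ a * r1 :=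
  (Commute.pow_right (show Commute r1 T2 from T2_r1) a)

theorem T1_T2_pow (b : ℕ) : T1 * T2 ^ b = T2 ^ b * T1 :=
  (Commute.pow_right (show Commute T1 T2 from T1_T2) b)

/-- The group element of a normal form. -/
def sec (x : X) : G := v x.1 * (T2 ^ x.2.2.1 * (T1 ^ x.2.1 * u x.2.2.2))

/-- Word length of a normal form. -/
def lenW (w : Fin 12) : ℕ := (w.val + 1) / 2

def len (x : X) : ℕ := x.1.val % 6 + 5 * (x.1.val / 6) + 6 * x.2.1 + 10 * x.2.2.1 + lenW x.2.2.2

theorem sec0 (x : X) : sec (A0 x) = r0 * sec x := by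
  obtain ⟨k, a, b, w⟩ := x
  fin_cases k
  · rcases b with _ | b
    · simp [sec, A0, v, u0, ← mul_assoc, T1_r0_pow]
    · simp [sec, A0, v, pow_succ', T2, mul_assoc, c00]
  · rcases b with _ | b
    · simp only [sec, A0, u0, pow_zero, one_mul]
      rw [← mul_assoc (T1 ^ a), ← T1_r0_pow, ← mul_assoc, ← mul_assoc r0, mul_assoc r0]
      simp [v, ← mul_assoc, b20]
    · simp [sec, A0, v, pow_succ', T2, mul_assoc, d20, c00]
  all_goals simp [sec, A0, v, pow_succ', T2, mul_assoc, d20, c00]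

/-- Moving one `T₁` to the front. -/
theorem sec_succ (k : Fin 12) (a b : ℕ) (w : Fin 12) :
    sec (k, a + 1, b, w) = (v k * T1) * (T2 ^ b * (T1 ^ a * u w)) := by
  simp only [sec, pow_succ', mul_assoc]
  rw [← mul_assoc T1 (T2 ^ b), T1_T2_pow, mul_assoc]

/-- Absorbing a reflection in the wall `a = 0`. -/
theorem sec_zero (k : Fin 12) (b : ℕ) (w : Fin 12) :
    sec (k, 0, b, m1 w) = (v k * r1) * (T2 ^ b * (T1 ^ 0 * u w)) := by
  simp only [sec, u1, pow_zero, one_mul, mul_assoc]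
  rw [← mul_assoc r1 (T2 ^ b), T2_r1_pow, mul_assoc]

theorem v1_5 : r1 * v 5 = v 0 * T1 := by simp [v, T1]
theorem v1_6 : r1 * v 6 = v 6 * r1 := by
  simp only [v, Matrix.cons_val, mul_assoc, d12, b12, d20]
theorem v1_11 : r1 * v 11 = v 6 * T1 := by
  simp only [v, T1, Matrix.cons_val, mul_assoc, d12, d20]
theorem v2_2 : r2 * v 2 = v 2 * r1 := by
  simp only [v, Matrix.cons_val, mul_assoc, b12]
theorem v2_3 : r2 * v 3 = v 3 * r1 := by
  simp only [v, Matrix.cons_val, mul_assoc, b12, d20]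
theorem v2_8 : r2 * v 8 = v 2 * T1 := by
  simp only [v, T1, Matrix.cons_val, mul_assoc, d12]
theorem v2_9 : r2 * v 9 = v 3 * T1 := by
  simp only [v, T1, Matrix.cons_val, mul_assoc, d12, d20]

/-- Steps that change only the `v` part. -/
theorem sec_step (s : G) (k k' a b w) (h : v k' = s * v k) :
    sec (k', a, b, w) = s * sec (k, a, b, w) := by
  simp only [sec, h, mul_assoc]

theorem sec_up (s : G) (k k' a b w) (h : s * v k = v k' * T1) :
    sec (k', a + 1, b, w) = s * sec (k, a, b, w) := by
  rw [sec_succ, ← h]; simp only [sec, mul_assoc]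

theorem sec_down (s : G) (k k' a b w) (hs : ∀ x, s * (s * x) = x) (h : s * v k' = v k * T1) :
    sec (k', a, b, w) = s * sec (k, a + 1, b, w) := by
  rw [sec_up s k' k a b w h, hs]

theorem sec_wall (s : G) (k b w) (h : s * v k = v k * r1) :
    sec (k, 0, b, m1 w) = s * sec (k, 0, b, w) := by
  rw [sec_zero, ← h]; simp only [sec, mul_assoc]

theorem sec1 (x : X) : sec (A1 x) = r1 * sec x := by
  obtain ⟨k, a, b, w⟩ := x
  fin_cases k
  · rcases a with _ | a
    · exact sec_wall r1 0 b w (by simp [v])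
    · exact sec_down r1 0 5 a b w c11 v1_5
  · exact sec_step r1 1 2 a b w (by simp [v])
  · exact sec_step r1 2 1 a b w (by simp [v, c11])
  · exact sec_step r1 3 4 a b w (by simp [v])
  · exact sec_step r1 4 3 a b w (by simp [v, c11])
  · exact sec_up r1 5 0 a b w v1_5
  · rcases a with _ | a
    · exact sec_wall r1 6 b w v1_6
    · exact sec_down r1 6 11 a b w c11 v1_11
  · exact sec_step r1 7 8 a b w (by simp [v])
  · exact sec_step r1 8 7 a b w (by simp [v, c11])
  · exact sec_step r1 9 10 a b w (by simp [v])
  · exact sec_step r1 10 9 a b w (by simp [v, c11])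
  · exact sec_up r1 11 6 a b w v1_11

theorem sec2 (x : X) : sec (A2 x) = r2 * sec x := by
  obtain ⟨k, a, b, w⟩ := x
  fin_cases k
  · exact sec_step r2 0 1 a b w (by simp [v])
  · exact sec_step r2 1 0 a b w (by simp [v, h22])
  · rcases a with _ | a
    · exact sec_wall r2 2 b w v2_2
    · exact sec_down r2 2 8 a b w c22 v2_8
  · rcases a with _ | a
    · exact sec_wall r2 3 b w v2_3
    · exact sec_down r2 3 9 a b w c22 v2_9
  · exact sec_step r2 4 6 a b w (by simp [v])
  · exact sec_step r2 5 7 a b w (by simp [v])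
  · exact sec_step r2 6 4 a b w (by simp [v, c22])
  · exact sec_step r2 7 5 a b w (by simp [v, c22])
  · exact sec_up r2 8 2 a b w v2_8
  · exact sec_up r2 9 3 a b w v2_9
  · exact sec_step r2 10 11 a b w (by simp [v])
  · exact sec_step r2 11 10 a b w (by simp [v, c22])

theorem sec_gen (i : Fin 3) (x : X) : sec (gen i x) = PresentedGroup.of i * sec x := by
  fin_cases i
  · exact sec0 x
  · exact sec1 x
  · exact sec2 x

theorem of_inv (i : Fin 3) : (PresentedGroup.of i : G)⁻¹ = PresentedGroup.of i := by
  fin_cases i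
  · exact i0
  · exact i1
  · exact i2

/-- The base point. -/
def e : X := (0, 0, 0, 0)

theorem sec_e : sec e = 1 := by simp [sec, e, v, u]

abbrev S : Set G := Set.range (PresentedGroup.of (rels := p6mRels))

theorem mem_S {x : G} (hx : x ∈ S ∪ S⁻¹) : ∃ i, x = PresentedGroup.of i := by
  rcases hx with ⟨i, rfl⟩ | ⟨i, hi⟩
  · exact ⟨i, rfl⟩
  · refine ⟨i, ?_⟩
    rw [← of_inv i, hi, inv_inv]

theorem sec_act (g : G) : ∀ x, sec (act g x) = g * sec x := by
  have hg : g ∈ Subgroup.closure S := by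
    rw [PresentedGroup.closure_range_of]; trivial
  induction hg using Subgroup.closure_induction with
  | mem y hy =>
    obtain ⟨i, rfl⟩ := hy
    intro x
    rw [act_of, sec_gen]
  | one => intro x; simp
  | mul y z _ _ hy hz =>
    intro x
    rw [map_mul, Equiv.Perm.mul_apply, hy, hz, mul_assoc]
  | inv y _ hy =>
    intro x
    have := hy ((act y⁻¹) x)
    rw [← Equiv.Perm.mul_apply, ← map_mul, mul_inv_cancel, map_one, Equiv.Perm.one_apply] at this
    rw [this, inv_mul_cancel_left]

theorem lenW_m0 (w : Fin 12) : lenW (m0 w) ≤ lenW w + 1 := by revert w; decide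
theorem lenW_m1 (w : Fin 12) : lenW (m1 w) ≤ lenW w + 1 := by revert w; decide

theorem len_gen (i : Fin 3) (x : X) : len (gen i x) ≤ len x + 1 := by
  obtain ⟨k, a, b, w⟩ := x
  have h0 := lenW_m0 w
  have h1 := lenW_m1 w
  fin_cases i
  · change len (A0 _) ≤ _
    fin_cases k <;> rcases b with _ | b <;> simp [A0, len] <;> omega
  · change len (A1 _) ≤ _
    fin_cases k <;> rcases a with _ | a <;> simp [A1, len] <;> omega
  · change len (A2 _) ≤ _
    fin_cases k <;> rcases a with _ | a <;> simp [A2, len] <;> omega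

theorem lenW_desc (w : Fin 12) (h : w ≠ 0) :
    lenW (m0 w) + 1 = lenW w ∨ lenW (m1 w) + 1 = lenW w := by revert w; decide

theorem len_desc (x : X) (h : len x ≠ 0) : ∃ i, len (gen i x) + 1 = len x := by
  obtain ⟨k, a, b, w⟩ := x
  fin_cases k
  · rcases b with _ | b
    · rcases a with _ | a
      · have hw : w ≠ 0 := by
          rintro rfl
          exact h rfl
        rcases lenW_desc w hw with hw | hw
        · exact ⟨0, by simp [A0, len]; omega⟩
        · exact ⟨1, by simp [A1, len]; omega⟩
      · exact ⟨1, by simp [A1, len]; omega⟩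
    · exact ⟨0, by simp [A0, len]; omega⟩
  · exact ⟨2, by simp [A2, len]; omega⟩
  · exact ⟨1, by simp [A1, len]; omega⟩
  · exact ⟨0, by simp [A0, len]; omega⟩
  · exact ⟨1, by simp [A1, len]; omega⟩
  · exact ⟨0, by simp [A0, len]; omega⟩
  · exact ⟨2, by simp [A2, len]; omega⟩
  · exact ⟨0, by simp [A0, len]; omega⟩
  · exact ⟨1, by simp [A1, len]; omega⟩
  · exact ⟨0, by simp [A0, len]; omega⟩
  · exact ⟨1, by simp [A1, len]; omega⟩
  · exact ⟨2, by simp [A2, len]; omega⟩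

theorem len_zero (x : X) (h : len x = 0) : x = e := by
  obtain ⟨k, a, b, w⟩ := x
  simp only [len, lenW] at h
  have hk : k = 0 := Fin.ext (by simp; omega)
  have hw : w = 0 := Fin.ext (by simp; omega)
  have ha : a = 0 := by omega
  have hb : b = 0 := by omega
  rw [hk, ha, hb, hw, e]

/-- Every normal form is reached by a word of the right length. -/
theorem exists_word (n : ℕ) : ∀ x : X, len x = n →
    ∃ l : List G, (∀ y ∈ l, y ∈ S ∪ S⁻¹) ∧ l.length = n ∧ act l.prod e = x := by
  induction n with
  | zero =>
    intro x hx
    exact ⟨[], by simp, rfl, by simp [len_zero x hx]⟩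
  | succ n ih =>
    intro x hx
    obtain ⟨i, hi⟩ := len_desc x (by omega)
    obtain ⟨l, hl, hn, hp⟩ := ih (gen i x) (by omega)
    refine ⟨PresentedGroup.of i :: l, ?_, by simp [hn], ?_⟩
    · intro y hy
      rcases List.mem_cons.1 hy with rfl | hy
      · exact Or.inl ⟨i, rfl⟩
      · exact hl y hy
    · rw [List.prod_cons, map_mul, Equiv.Perm.mul_apply, hp, ← act_of, ← Equiv.Perm.mul_apply,
        ← map_mul]
      have : (PresentedGroup.of i * PresentedGroup.of i : G) = 1 := by
        nth_rewrite 1 [← of_inv i]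
        exact inv_mul_cancel _
      rw [this, map_one, Equiv.Perm.one_apply]

theorem len_word (l : List G) (h : ∀ y ∈ l, y ∈ S ∪ S⁻¹) : len (act l.prod e) ≤ l.length := by
  induction l with
  | nil => simp [e, len, lenW]
  | cons y l ih =>
    obtain ⟨i, rfl⟩ := mem_S (h y (by simp))
    have := ih (fun z hz => h z (by simp [hz]))
    rw [List.prod_cons, map_mul, Equiv.Perm.mul_apply, act_of, List.length_cons]
    exact (len_gen i _).trans (by omega)

theorem sec_orbit (g : G) : sec (act g e) = g := by rw [sec_act, sec_e, mul_one]

theorem orbit_sec (x : X) : act (sec x) e = x := by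
  obtain ⟨l, _, _, hp⟩ := exists_word _ x rfl
  rw [← hp, sec_orbit]

theorem wordLength_eq (g : G) : wordLength S g = len (act g e) := by
  apply le_antisymm
  · obtain ⟨l, hl, hn, hp⟩ := exists_word _ (act g e) rfl
    refine Nat.sInf_le ⟨l, hl, hn, ?_⟩
    rw [← sec_orbit l.prod, hp, sec_orbit]
  · obtain ⟨l, hl, hn, hp⟩ := exists_word _ (act g e) rfl
    have hne : {n | ∃ w : List G, (∀ x ∈ w, x ∈ S ∪ S⁻¹) ∧ w.length = n ∧ w.prod = g}.Nonempty :=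
      ⟨_, l, hl, hn, by rw [← sec_orbit l.prod, hp, sec_orbit]⟩
    obtain ⟨l', hl', hn', hp'⟩ := Nat.sInf_mem hne
    have := len_word l' hl'
    rw [hp', hn'] at this
    exact this

/-- The parametrization of the normal forms of length `n`. -/
def par (n : ℕ) (p : Σ _ : Fin 12, ℕ) : X :=
  (⟨(n - lenW p.1 - 5 * p.2) % 6 + 6 * (p.2 % 2), by omega⟩,
    (n - lenW p.1 - 5 * p.2) / 6, p.2 / 2, p.1)

theorem growth_eq (n : ℕ) : sphericalGrowth (Set.range (PresentedGroup.of (rels := p6mRels))) n =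
    ∑ w : Fin 12, (n + 5 - lenW w) / 5 := by
  have h1 : {g : G | wordLength S g = n} =
      Set.image (fun p => sec (par n p))
        ((Finset.univ.sigma fun w : Fin 12 => Finset.range ((n + 5 - lenW w) / 5) :
          Finset (Σ _ : Fin 12, ℕ)) : Set (Σ _ : Fin 12, ℕ)) := by
    ext g
    simp only [Set.mem_setOf_eq, wordLength_eq, Set.mem_image, Finset.mem_coe, Finset.mem_sigma,
      Finset.mem_univ, true_and, Finset.mem_range]
    constructor
    · intro h
      rcases hx : act g e with ⟨k, a, b, w⟩
      rw [hx] at h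
      simp only [len] at h
      refine ⟨⟨w, k.val / 6 + 2 * b⟩, ?_, ?_⟩
      · dsimp only
        omega
      · have : par n ⟨w, k.val / 6 + 2 * b⟩ = (k, a, b, w) := by
          have hk := k.isLt
          simp only [par, Prod.mk.injEq, and_true]
          refine ⟨Fin.ext ?_, ?_, ?_⟩
          · dsimp only
            omega
          · omega
          · omega
        rw [this, ← hx, sec_orbit]
    · rintro ⟨⟨w, r⟩, hr, rfl⟩
      dsimp only at hr
      rw [orbit_sec]
      simp only [par, len]
      omega
  unfold sphericalGrowth
  rw [h1, Set.InjOn.ncard_image, Set.ncard_coe_finset, Finset.card_sigma]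
  · simp
  · rintro ⟨w, r⟩ _ ⟨w2, r2⟩ _ h
    have h2 := congrArg (fun g => act g e) h
    simp only [orbit_sec, par, Prod.mk.injEq, Fin.mk.injEq] at h2
    obtain ⟨h3, h4, h5, rfl⟩ := h2
    have : r = r2 := by omega
    rw [this]

end P6M

/-- Spherical growth of `p6m` with generators `R,R₁,R₂` (Cayley graph: the tiling `4.6.12`):
`δ(0) = 1` and for `n > 0`: `δ(n) = 12n/5, (12n+3)/5, (12n+1)/5, (12n-1)/5, (12n-3)/5`
according to `n mod 5 = 0,1,2,3,4` (stated multiplied by 5 to avoid division). -/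
theorem sphericalGrowth_p6m :
    sphericalGrowth (Set.range (PresentedGroup.of (rels := p6mRels))) 0 = 1 ∧
    ∀ n : ℕ, 0 < n →
      (n % 5 = 0 →
        5 * sphericalGrowth (Set.range (PresentedGroup.of (rels := p6mRels))) n = 12 * n) ∧
      (n % 5 = 1 →
        5 * sphericalGrowth (Set.range (PresentedGroup.of (rels := p6mRels))) n = 12 * n + 3) ∧
      (n % 5 = 2 →
        5 * sphericalGrowth (Set.range (PresentedGroup.of (rels := p6mRels))) n = 12 * n + 1) ∧
      (n % 5 = 3 →
        5 * sphericalGrowth (Set.range (PresentedGroup.of (rels := p6mRels))) n + 1 = 12 * n) ∧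
      (n % 5 = 4 →
        5 * sphericalGrowth (Set.range (PresentedGroup.of (rels := p6mRels))) n + 3 = 12 * n) := by
  simp only [P6M.growth_eq]
  have hsum : ∀ n : ℕ, ∑ w : Fin 12, (n + 5 - P6M.lenW w) / 5 =
      (n + 5) / 5 + 2 * ((n + 4) / 5) + 2 * ((n + 3) / 5) + 2 * ((n + 2) / 5)
      + 2 * ((n + 1) / 5) + 2 * (n / 5) + (n + 5 - 6) / 5 := by
    intro n
    simp [Fin.sum_univ_succ, P6M.lenW]
    omega
  simp only [hsum]
  refine ⟨by norm_num, fun n hn => ⟨?_, ?_, ?_, ?_, ?_⟩⟩ <;> intro h <;> omega
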